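/- arXiv:2202.11315 — 2 statements merged into one kernel-verified Lean document; each statement's English description precedes it below -/
import Mathlib

section
/- For every fixed v ∈ E and all −1 < ε₁ < ε₂, setting κ := (ε₂ − ε₁)/(1 + ε₁) > 0, one has L(v/(1+ε₂)) ≤ (κ+1)^{−1} L(v/(1+ε₁)) + κ(κ+1)^{−1} θ₁*(0), and f(ε₂) ≤ κ^{−1} L(v/(1+ε₁)) − (κ^{−1}+1) L(v/(1+ε₂)), where f(ε) := ⟨DL(v/(1+ε)), v/(1+ε)⟩ − L(v/(1+ε)). -/
open scoped RealInnerProductSpace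
open Filter

noncomputable section

/-- The first-order characterization of convexity: a convex function lies above its tangent
hyperplanes. -/
theorem add_inner_gradient_le_of_convexOn {E : Type*} [NormedAddCommGroup E]
    [InnerProductSpace ℝ E] [CompleteSpace E] {L : E → ℝ} (hL : ConvexOn ℝ Set.univ L) {x : E}
    (hx : DifferentiableAt ℝ L x) (y : E) :
    L x + ⟪gradient L x, y - x⟫ ≤ L y := by
  have conv : ConvexOn ℝ Set.univ (L ∘ AffineMap.lineMap (k := ℝ) x y) := by
    simpa using hL.comp_affineMap (AffineMap.lineMap (k := ℝ) x y)
  have deriv_zero : HasDerivAt (L ∘ AffineMap.lineMap (k := ℝ) x y)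
      ⟪gradient L x, y - x⟫ 0 := by
    have hL' : HasFDerivAt L (InnerProductSpace.toDual ℝ E (gradient L x))
        (AffineMap.lineMap (k := ℝ) x y 0) := by
      simpa using hx.hasGradientAt.hasFDerivAt
    simpa using hL'.comp_hasDerivAt (0 : ℝ) AffineMap.hasDerivAt_lineMap
  have slope_le := conv.le_slope_of_hasDerivAt (Set.mem_univ 0) (Set.mem_univ 1) zero_lt_one
    deriv_zero
  simp only [slope_def_field, Function.comp_apply, AffineMap.lineMap_apply_one,
    AffineMap.lineMap_apply_zero, sub_zero, div_one] at slope_le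
  linarith

/-- for fixed `v` and `-1 < ε₁ < ε₂`, with `κ = (ε₂ − ε₁)/(1 + ε₁) > 0`,
`L(v/(1+ε₂)) ≤ (κ+1)⁻¹ L(v/(1+ε₁)) + κ(κ+1)⁻¹ θ₁*(0)` and
`f(ε₂) ≤ κ⁻¹ L(v/(1+ε₁)) − (κ⁻¹+1) L(v/(1+ε₂))`, where
`f(ε) = ⟨∇L(v/(1+ε)), v/(1+ε)⟩ − L(v/(1+ε))`. -/
theorem stmt_14 {E : Type*} [NormedAddCommGroup E] [InnerProductSpace ℝ E]
    [FiniteDimensional ℝ E]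
    (L : E → ℝ) (hLconv : ConvexOn ℝ Set.univ L) (hLC1 : ContDiff ℝ 1 L)
    (θ₁ θ₂ : ℝ → ℝ)
    (hθ₁0 : ∀ r : ℝ, 0 ≤ r → 0 ≤ θ₁ r) (hθ₂0 : ∀ r : ℝ, 0 ≤ r → 0 ≤ θ₂ r)
    (hθ₁ : Tendsto (fun r => θ₁ r / r) atTop atTop)
    (hθ₂ : Tendsto (fun r => θ₂ r / r) atTop atTop)
    (hpinch : ∀ v : E, θ₂ ‖v‖ ≤ L v ∧ L v ≤ θ₁ ‖v‖)
    (v : E)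
    (f : ℝ → ℝ)
    (hf : ∀ ε : ℝ, f ε =
      ⟪gradient L ((1 + ε)⁻¹ • v), (1 + ε)⁻¹ • v⟫ - L ((1 + ε)⁻¹ • v))
    (ε₁ ε₂ : ℝ) (hε₁ : -1 < ε₁) (hε₁₂ : ε₁ < ε₂)
    (κ : ℝ) (hκ : κ = (ε₂ - ε₁) / (1 + ε₁)) :
    0 < κ ∧
    L ((1 + ε₂)⁻¹ • v) ≤ (κ + 1)⁻¹ * L ((1 + ε₁)⁻¹ • v) + κ * (κ + 1)⁻¹ * θ₁ 0 ∧
    f ε₂ ≤ κ⁻¹ * L ((1 + ε₁)⁻¹ • v) - (κ⁻¹ + 1) * L ((1 + ε₂)⁻¹ • v) := by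
  have h₁ : 0 < 1 + ε₁ := by linarith
  have h₂ : 0 < 1 + ε₂ := by linarith
  have κ_pos : 0 < κ := by
    rw [hκ]
    exact div_pos (by linarith) h₁
  have smul_eq : (1 + ε₁)⁻¹ • v = (κ + 1) • (1 + ε₂)⁻¹ • v := by
    rw [smul_smul, hκ]
    congr 1
    field_simp
    ring
  rw [hf, smul_eq]
  generalize (1 + ε₂)⁻¹ • v = w
  refine ⟨κ_pos, ?_, ?_⟩
  · have zero_le : L 0 ≤ θ₁ 0 := by simpa using (hpinch 0).2
    have sum_eq_one : (κ + 1)⁻¹ + κ * (κ + 1)⁻¹ = 1 := by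
      field_simp
      ring
    have key := hLconv.2 (Set.mem_univ ((κ + 1) • w)) (Set.mem_univ (0 : E))
      (by positivity : 0 ≤ (κ + 1)⁻¹) (by positivity : 0 ≤ κ * (κ + 1)⁻¹) sum_eq_one
    rw [smul_zero, add_zero, inv_smul_smul₀ (by positivity)] at key
    simp only [smul_eq_mul] at key
    exact key.trans (by gcongr)
  · have grad := add_inner_gradient_le_of_convexOn hLconv
      (hLC1.differentiable one_ne_zero w) ((κ + 1) • w)
    have sub_eq : (κ + 1) • w - w = κ • w := by module
    rw [sub_eq, inner_smul_right] at grad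
    rw [← mul_le_mul_iff_of_pos_left κ_pos]
    have rhs_eq : κ * (κ⁻¹ * L ((κ + 1) • w) - (κ⁻¹ + 1) * L w)
        = L ((κ + 1) • w) - (1 + κ) * L w := by
      field_simp
    rw [rhs_eq]
    linarith
end
end

section
/- On the circle 𝕊¹ = ℝ/2πℤ, the Hamilton–Jacobi equation (1/2)|u'(x)|² + sin(x)·u(x) + cos(2x) − 1 = 0 admits exactly one continuous viscosity solution: a continuous viscosity solution exists, and any two continuous viscosity solutions coincide. -/
noncomputable section

/-- Viscosity subsolution, on the circle `𝕊¹ = ℝ/2πℤ` (identified with `2π`-periodic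
functions on `ℝ`), of `(1/2)|u'|² + sin(x)·u + cos(2x) − 1 = 0`. -/
def CircleSubsol (u : ℝ → ℝ) : Prop :=
  ∀ ψ : ℝ → ℝ, ContDiff ℝ 1 ψ →
    ∀ x : ℝ, IsLocalMax (fun y => u y - ψ y) x →
      (1 / 2) * (deriv ψ x) ^ 2 + Real.sin x * u x + Real.cos (2 * x) - 1 ≤ 0

/-- Viscosity supersolution of `(1/2)|u'|² + sin(x)·u + cos(2x) − 1 = 0` on the circle. -/
def CircleSupersol (u : ℝ → ℝ) : Prop :=
  ∀ ψ : ℝ → ℝ, ContDiff ℝ 1 ψ →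
    ∀ x : ℝ, IsLocalMin (fun y => u y - ψ y) x →
      0 ≤ (1 / 2) * (deriv ψ x) ^ 2 + Real.sin x * u x + Real.cos (2 * x) - 1

/-- A continuous `2π`-periodic viscosity solution of
`(1/2)|u'|² + sin(x)·u + cos(2x) − 1 = 0` on the circle. -/
def CircleSolution (u : ℝ → ℝ) : Prop :=
  Continuous u ∧ Function.Periodic u (2 * Real.pi) ∧ CircleSubsol u ∧ CircleSupersol u

open Set Filter Topology

lemma ContDiffAt.exists_contDiff_eventuallyEq {ψ : ℝ → ℝ} {x : ℝ} (h : ContDiffAt ℝ 1 ψ x) :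
    ∃ φ : ℝ → ℝ, ContDiff ℝ 1 φ ∧ φ =ᶠ[𝓝 x] ψ := by
  obtain ⟨R, hR, hball⟩ := Metric.eventually_nhds_iff_ball.1 (h.eventually (by simp))
  let χ : ContDiffBump x := ⟨R / 3, R / 2, by positivity, by linarith⟩
  refine ⟨fun y => χ y * ψ y, contDiff_iff_contDiffAt.2 fun y => ?_, ?_⟩
  · by_cases hy : y ∈ tsupport χ
    · refine χ.contDiff.contDiffAt.mul (hball y ?_)
      rw [χ.tsupport_eq] at hy
      exact Metric.closedBall_subset_ball (by change R / 2 < R; linarith) hy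
    · refine contDiffAt_const (c := (0 : ℝ)) |>.congr_of_eventuallyEq ?_
      filter_upwards [notMem_tsupport_iff_eventuallyEq.1 hy] with z hz
      simp [hz]
  · filter_upwards [χ.eventuallyEq_one] with y hy
    simp [hy]

lemma IsLocalMaxOn.right_deriv_nonpos {f : ℝ → ℝ} {p x : ℝ} (h : IsLocalMaxOn f (Ici x) x)
    (hf : HasDerivWithinAt f p (Ici x) x) : p ≤ 0 := by
  have := h.hasFDerivWithinAt_nonpos hf.hasFDerivWithinAt (y := 1) (by
    have := sub_mem_posTangentConeAt_of_segment_subset (x := x) (y := x + 1) (s := Ici x) (by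
      rw [segment_eq_Icc (by linarith)]; exact Icc_subset_Ici_self)
    simpa using this)
  simpa using this

lemma IsLocalMaxOn.left_deriv_nonneg {f : ℝ → ℝ} {p x : ℝ} (h : IsLocalMaxOn f (Iic x) x)
    (hf : HasDerivWithinAt f p (Iic x) x) : 0 ≤ p := by
  have := h.hasFDerivWithinAt_nonpos hf.hasFDerivWithinAt (y := -1) (by
    have := sub_mem_posTangentConeAt_of_segment_subset (x := x) (y := x - 1) (s := Iic x) (by
      rw [segment_symm, segment_eq_Icc (by linarith)]; exact Icc_subset_Iic_self)
    simpa using this)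
  simpa using this

/-- `v` is a viscosity subsolution of `p² = 2 sin x (2 sin x - ε v)`. -/
def ViscSub (ε : ℝ) (v : ℝ → ℝ) : Prop :=
  ∀ (ψ : ℝ → ℝ) (x p : ℝ), ContDiffAt ℝ 1 ψ x → HasDerivAt ψ p x →
    IsLocalMax (fun y => v y - ψ y) x → p ^ 2 ≤ 2 * Real.sin x * (2 * Real.sin x - ε * v x)

/-- `v` is a viscosity supersolution of `p² = 2 sin x (2 sin x - ε v)`. -/
def ViscSuper (ε : ℝ) (v : ℝ → ℝ) : Prop :=
  ∀ (ψ : ℝ → ℝ) (x p : ℝ), ContDiffAt ℝ 1 ψ x → HasDerivAt ψ p x →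
    IsLocalMin (fun y => v y - ψ y) x → 2 * Real.sin x * (2 * Real.sin x - ε * v x) ≤ p ^ 2

lemma CircleSubsol.viscSub {u : ℝ → ℝ} (h : CircleSubsol u) : ViscSub 1 u := by
  intro ψ x p hψ hp hmax
  obtain ⟨φ, hφ, hφψ⟩ := hψ.exists_contDiff_eventuallyEq
  have h1 := h φ hφ x (hmax.congr (by filter_upwards [hφψ] with y hy; simp [hy]))
  rw [hφψ.deriv_eq, hp.deriv, Real.cos_two_mul, Real.cos_sq'] at h1
  linarith

lemma CircleSupersol.viscSuper {u : ℝ → ℝ} (h : CircleSupersol u) : ViscSuper 1 u := by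
  intro ψ x p hψ hp hmin
  obtain ⟨φ, hφ, hφψ⟩ := hψ.exists_contDiff_eventuallyEq
  have h1 := h φ hφ x (hmin.congr (by filter_upwards [hφψ] with y hy; simp [hy]))
  rw [hφψ.deriv_eq, hp.deriv, Real.cos_two_mul, Real.cos_sq'] at h1
  linarith

lemma ViscSub.comp_neg {ε : ℝ} {v : ℝ → ℝ} (h : ViscSub ε v) :
    ViscSub (-ε) (fun x => v (-x)) := by
  intro ψ x p hψ hp hmax
  have h1 := h (fun y => ψ (-y)) (-x) (-p)
    (ContDiffAt.comp (-x) (by simpa using hψ) contDiffAt_id.neg)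
    (HasDerivAt.scomp (-x) (by simpa using hp) (hasDerivAt_neg (-x)) |>.congr_deriv (by simp))
    (by
      have := IsLocalMax.comp_continuous (g := fun y : ℝ => -y) (b := -x)
        (by simpa using hmax) continuous_neg.continuousAt
      simpa [Function.comp_def] using this)
  simp only [Real.sin_neg] at h1
  linarith

lemma ViscSuper.comp_neg {ε : ℝ} {v : ℝ → ℝ} (h : ViscSuper ε v) :
    ViscSuper (-ε) (fun x => v (-x)) := by
  intro ψ x p hψ hp hmin
  have h1 := h (fun y => ψ (-y)) (-x) (-p)
    (ContDiffAt.comp (-x) (by simpa using hψ) contDiffAt_id.neg)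
    (HasDerivAt.scomp (-x) (by simpa using hp) (hasDerivAt_neg (-x)) |>.congr_deriv (by simp))
    (by
      have := IsLocalMin.comp_continuous (g := fun y : ℝ => -y) (b := -x)
        (by simpa using hmin) continuous_neg.continuousAt
      simpa [Function.comp_def] using this)
  simp only [Real.sin_neg] at h1
  linarith

lemma ViscSub.comp_pi_sub {ε : ℝ} {v : ℝ → ℝ} (h : ViscSub ε v) :
    ViscSub ε (fun x => v (Real.pi - x)) := by
  intro ψ x p hψ hp hmax
  have hx : Real.pi - (Real.pi - x) = x := by ring
  have h1 := h (fun y => ψ (Real.pi - y)) (Real.pi - x) (-p)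
    (ContDiffAt.comp (Real.pi - x) (by simpa using hψ) (contDiffAt_const.sub contDiffAt_id))
    (HasDerivAt.comp_const_sub Real.pi (Real.pi - x) (by simpa using hp))
    (by
      have := IsLocalMax.comp_continuous (g := fun y : ℝ => Real.pi - y) (b := Real.pi - x)
        (by simpa using hmax) (by fun_prop)
      simpa [Function.comp_def] using this)
  simp only [Real.sin_pi_sub] at h1
  linarith

lemma ViscSuper.comp_pi_sub {ε : ℝ} {v : ℝ → ℝ} (h : ViscSuper ε v) :
    ViscSuper ε (fun x => v (Real.pi - x)) := by
  intro ψ x p hψ hp hmin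
  have hx : Real.pi - (Real.pi - x) = x := by ring
  have h1 := h (fun y => ψ (Real.pi - y)) (Real.pi - x) (-p)
    (ContDiffAt.comp (Real.pi - x) (by simpa using hψ) (contDiffAt_const.sub contDiffAt_id))
    (HasDerivAt.comp_const_sub Real.pi (Real.pi - x) (by simpa using hp))
    (by
      have := IsLocalMin.comp_continuous (g := fun y : ℝ => Real.pi - y) (b := Real.pi - x)
        (by simpa using hmin) (by fun_prop)
      simpa [Function.comp_def] using this)
  simp only [Real.sin_pi_sub] at h1
  linarith

/-- A viscosity subsolution can only take values where the equation is solvable for the slope. -/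
lemma ViscSub.hamiltonian_nonneg {ε : ℝ} {v : ℝ → ℝ} (h : ViscSub ε v) (hv : Continuous v)
    (x : ℝ) : 0 ≤ 2 * Real.sin x * (2 * Real.sin x - ε * v x) := by
  by_contra! hneg
  obtain ⟨R, hR, hball⟩ := Metric.eventually_nhds_iff_ball.1
    ((show ContinuousAt (fun x => 2 * Real.sin x * (2 * Real.sin x - ε * v x)) x by
      fun_prop).eventually_lt_const hneg)
  set r := R / 2 with hr
  have hr0 : 0 < r := by positivity
  obtain ⟨M, hM⟩ := (isCompact_Icc (a := x - r) (b := x + r)).exists_bound_of_continuousOn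
    hv.continuousOn
  have hM0 : 0 ≤ M := (norm_nonneg _).trans (hM x ⟨by linarith, by linarith⟩)
  set C := (2 * M + 1) / r ^ 2 with hC
  have hCr : C * r ^ 2 = 2 * M + 1 := by rw [hC]; field_simp
  obtain ⟨z, hz, hzmax⟩ := (isCompact_Icc (a := x - r) (b := x + r)).exists_isMaxOn
    ⟨x, by constructor <;> linarith⟩
    (f := fun y => v y - C * (y - x) ^ 2) (by fun_prop)
  have hxz := hzmax (show x ∈ Icc (x - r) (x + r) by constructor <;> linarith)
  simp only [mem_ofPred_eq, sub_self, ne_eq, OfNat.ofNat_ne_zero, not_false_eq_true, zero_pow,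
    mul_zero, sub_zero] at hxz
  have b1 := abs_le.1 (hM x ⟨by linarith, by linarith⟩)
  have b2 := abs_le.1 (hM z hz)
  have hz' : z ∈ Ioo (x - r) (x + r) := by
    refine ⟨lt_of_le_of_ne hz.1 ?_, lt_of_le_of_ne hz.2 ?_⟩
    · rintro rfl
      have : C * (x - r - x) ^ 2 = 2 * M + 1 := by rw [← hCr]; ring
      linarith
    · rintro rfl
      have : C * (x + r - x) ^ 2 = 2 * M + 1 := by rw [← hCr]; ring
      linarith
  have h1 := h (fun y => C * (y - x) ^ 2) z (C * (2 * (z - x)))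
    (by fun_prop) (by
      simpa using (((hasDerivAt_id z).sub_const x).pow 2).const_mul C)
    (hzmax.isLocalMax (Icc_mem_nhds hz'.1 hz'.2))
  have h2 := hball z (by
    rw [Metric.mem_ball, Real.dist_eq, abs_lt]; constructor <;> linarith [hz'.1, hz'.2])
  nlinarith [sq_nonneg (C * (2 * (z - x)))]

/-- A continuous function that is nonpositive at `a` and positive somewhere on `(a, b)` can be
touched from above at an interior point by a positive function growing at rate at least `K`. -/
lemma exists_touching_above {g : ℝ → ℝ} {a b x : ℝ} (K : ℝ) (hg : ContinuousOn g (Icc a b))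
    (ha : g a ≤ 0) (hx : x ∈ Ioo a b) (hgx : 0 < g x) :
    ∃ z ∈ Ioo a b, ∃ (q : ℝ → ℝ) (q' : ℝ), ContDiffAt ℝ 1 q z ∧ HasDerivAt q q' z ∧
      0 < q z ∧ K * q z ≤ q' ∧ g z = q z ∧ ∀ᶠ y in 𝓝 z, g y ≤ q y := by
  obtain ⟨z, hz, hzmax⟩ := (isCompact_Icc (a := a) (b := b)).exists_isMaxOn
    ⟨x, Ioo_subset_Icc_self hx⟩ (f := fun y => g y * ((b - y) * Real.exp (-(K * y))))
    (by fun_prop)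
  set m := g z * ((b - z) * Real.exp (-(K * z))) with hm
  have hm0 : 0 < m := lt_of_lt_of_le
    (mul_pos hgx (mul_pos (sub_pos.2 hx.2) (Real.exp_pos _))) (hzmax (Ioo_subset_Icc_self hx))
  have hz' : z ∈ Ioo a b := by
    refine ⟨lt_of_le_of_ne hz.1 ?_, lt_of_le_of_ne hz.2 ?_⟩
    · rintro rfl
      have := mul_pos (sub_pos.2 (hx.1.trans hx.2)) (Real.exp_pos (-(K * a)))
      nlinarith
    · rintro rfl
      simp [hm] at hm0
  have hbz : 0 < b - z := sub_pos.2 hz'.2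
  have hd : HasDerivAt (fun y => m * (Real.exp (K * y) / (b - y)))
      (m * (Real.exp (K * z) / (b - z) * (K + 1 / (b - z)))) z := by
    have h1 : HasDerivAt (fun y => Real.exp (K * y)) (Real.exp (K * z) * K) z := by
      simpa using ((hasDerivAt_id z).const_mul K).exp
    have h2 : HasDerivAt (fun y => b - y) (-1) z := by
      simpa using (hasDerivAt_id z).const_sub b
    refine ((h1.div h2 hbz.ne').const_mul m).congr_deriv ?_
    field_simp
    ring
  have key : ∀ y, y < b → g y * ((b - y) * Real.exp (-(K * y))) ≤ m →
      g y ≤ m * (Real.exp (K * y) / (b - y)) := by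
    intro y hy hle
    rw [← mul_div_assoc, le_div_iff₀ (sub_pos.2 hy)]
    have := mul_le_mul_of_nonneg_right hle (Real.exp_pos (K * y)).le
    rwa [mul_assoc, mul_assoc, ← Real.exp_add, neg_add_cancel, Real.exp_zero, mul_one] at this
  have hq : 0 < m * (Real.exp (K * z) / (b - z)) :=
    mul_pos hm0 (div_pos (Real.exp_pos _) hbz)
  refine ⟨z, hz', _, _, ?_, hd, hq, ?_, ?_, ?_⟩
  · exact contDiffAt_const.mul (((contDiffAt_const.mul contDiffAt_id).exp).div
      (contDiffAt_const.sub contDiffAt_id) hbz.ne')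
  · have : 0 < m * (Real.exp (K * z) / (b - z)) * (1 / (b - z)) := by positivity
    nlinarith
  · rw [hm]
    have := Real.exp_add (-(K * z)) (K * z)
    rw [neg_add_cancel, Real.exp_zero] at this
    field_simp
    rw [mul_comm z K]
    linear_combination g z * this
  · filter_upwards [Icc_mem_nhds hz'.1 hz'.2, Iio_mem_nhds hz'.2] with y hy hyb
    exact key y hyb (hzmax hy)

/-- The branch of the solution that rises from the value `0` at `0`, on a quarter of the circle. -/
structure RisingBranch (ε : ℝ) (F f : ℝ → ℝ) : Prop where
  cont : Continuous F
  zero : F 0 = 0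
  deriv : ∀ t ∈ Icc 0 (Real.pi / 2), HasDerivWithinAt F (f t) (Icc 0 (Real.pi / 2)) t
  contDeriv : ContinuousOn f (Icc 0 (Real.pi / 2))
  sq : ∀ t ∈ Icc 0 (Real.pi / 2), f t ^ 2 = 2 * Real.sin t * (2 * Real.sin t - ε * F t)
  lower : ∀ t ∈ Icc 0 (Real.pi / 2), 2 / 5 * Real.sin t ≤ f t

namespace RisingBranch

variable {ε : ℝ} {F f v : ℝ → ℝ}

lemma hasDerivAt (h : RisingBranch ε F f) {t : ℝ} (ht : t ∈ Ioo 0 (Real.pi / 2)) :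
    HasDerivAt F (f t) t :=
  (h.deriv t (Ioo_subset_Icc_self ht)).hasDerivAt (Icc_mem_nhds ht.1 ht.2)

lemma contDiffAt (h : RisingBranch ε F f) {t : ℝ} (ht : t ∈ Ioo 0 (Real.pi / 2)) :
    ContDiffAt ℝ 1 F t := by
  refine contDiffAt_one_iff.2 ⟨fun y => ContinuousLinearMap.toSpanSingleton ℝ (f y),
    Ioo 0 (Real.pi / 2), Ioo_mem_nhds ht.1 ht.2, ?_, fun y hy => (h.hasDerivAt hy).hasFDerivAt⟩
  exact (ContinuousLinearMap.toSpanSingletonCLE (𝕜 := ℝ) (E := ℝ)).continuous.comp_continuousOn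
    (h.contDeriv.mono Ioo_subset_Icc_self)

lemma sin_pos {t : ℝ} (ht : t ∈ Ioo 0 (Real.pi / 2)) : 0 < Real.sin t :=
  Real.sin_pos_of_pos_of_lt_pi ht.1 (by linarith [ht.2, Real.pi_pos])

lemma monotoneOn (h : RisingBranch ε F f) : MonotoneOn F (Icc 0 (Real.pi / 2)) := by
  refine monotoneOn_of_deriv_nonneg (convex_Icc _ _) h.cont.continuousOn ?_ ?_
  · rw [interior_Icc]
    exact fun t ht => (h.hasDerivAt ht).differentiableAt.differentiableWithinAt
  · rw [interior_Icc]
    intro t ht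
    rw [(h.hasDerivAt ht).deriv]
    linarith [h.lower t (Ioo_subset_Icc_self ht), sin_pos ht]

lemma le_on_Icc_of_Ioo {g k : ℝ → ℝ} {a b : ℝ} (hab : a < b) (hg : Continuous g)
    (hk : Continuous k) (h : ∀ t ∈ Ioo a b, g t ≤ k t) : ∀ t ∈ Icc a b, g t ≤ k t := by
  intro t ht
  exact le_on_closure h hg.continuousOn hk.continuousOn (by rwa [closure_Ioo hab.ne])

/-- Subsolutions vanishing at `0` stay below the rising branch. -/
lemma le_of_viscSub (h : RisingBranch ε F f) (hε : |ε| ≤ 1) (hv : Continuous v) (hv0 : v 0 = 0)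
    (hsub : ViscSub ε v) : ∀ t ∈ Icc 0 (Real.pi / 2), v t ≤ F t := by
  refine le_on_Icc_of_Ioo (by positivity) hv h.cont fun t ht => ?_
  by_contra! hlt
  obtain ⟨z, hz, q, q', hq, hq', hq0, hK, hzq, hle⟩ := exists_touching_above
    (g := fun y => v y - F y) 6 (hv.sub h.cont).continuousOn (by simp [hv0, h.zero]) ht
    (sub_pos.2 hlt)
  have h1 := hsub (fun y => F y + q y) z (f z + q') ((h.contDiffAt hz).add hq)
    ((h.hasDerivAt hz).add hq') (by
      filter_upwards [hle] with y hy
      linarith)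
  have hs := sin_pos hz
  have hz' := Ioo_subset_Icc_self hz
  have h2 := h.sq z hz'
  have h3 := h.lower z hz'
  have h4 : v z = F z + q z := by linarith
  rw [h4] at h1
  have h5 := abs_le.1 hε
  have h6 : 0 < Real.sin z * q z := mul_pos hs hq0
  have h7 : f z * (6 * q z) ≤ f z * q' := mul_le_mul_of_nonneg_left hK (by linarith)
  have h8 : 2 / 5 * Real.sin z * q z ≤ f z * q z := mul_le_mul_of_nonneg_right h3 hq0.le
  nlinarith [mul_le_mul_of_nonneg_right h5.1 h6.le, sq_nonneg q']

/-- Monotone supersolutions stay above the rising branch. -/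
lemma le_of_viscSuper (h : RisingBranch ε F f) (hε : |ε| ≤ 1) (hv : Continuous v)
    (hv0 : v 0 = 0) (hsuper : ViscSuper ε v) {m : ℝ} (hm : m ≤ Real.pi / 2)
    (hmono : MonotoneOn v (Icc 0 m)) : ∀ t ∈ Icc 0 m, F t ≤ v t := by
  intro t ht
  rcases ht.1.eq_or_lt with rfl | ht0
  · simp [hv0, h.zero]
  refine le_on_Icc_of_Ioo (ht0.trans_le ht.2) h.cont hv (fun t ht => ?_) t ht
  by_contra! hlt
  obtain ⟨z, hz, q, q', hq, hq', hq0, hK, hzq, hle⟩ := exists_touching_above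
    (g := fun y => F y - v y) 6 (h.cont.sub hv).continuousOn (by simp [hv0, h.zero]) ht
    (sub_pos.2 hlt)
  have hzp : z ∈ Ioo 0 (Real.pi / 2) := ⟨hz.1, hz.2.trans_le hm⟩
  have hd := (h.hasDerivAt hzp).sub hq'
  have hmin : IsLocalMin (fun y => v y - (F y - q y)) z := by
    filter_upwards [hle] with y hy
    linarith
  have h1 := hsuper (fun y => F y - q y) z (f z - q') ((h.contDiffAt hzp).sub hq) hd hmin
  have hnn : 0 ≤ f z - q' := by
    refine IsLocalMaxOn.left_deriv_nonneg (f := fun y => F y - q y) (x := z) ?_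
      hd.hasDerivWithinAt
    filter_upwards [mem_nhdsWithin_of_mem_nhds hmin,
      mem_nhdsWithin_of_mem_nhds (Ioi_mem_nhds hz.1), self_mem_nhdsWithin] with y hy hy0 hyz
    have hy0 : 0 < y := hy0
    have hyz : y ≤ z := hyz
    have := hmono ⟨hy0.le, hyz.trans hz.2.le⟩ (Ioo_subset_Icc_self hz) hyz
    have hy : v z - (F z - q z) ≤ v y - (F y - q y) := hy
    linarith
  have hs := sin_pos hzp
  have hz' := Ioo_subset_Icc_self hzp
  have h2 := h.sq z hz'
  have h3 := h.lower z hz'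
  have h4 : v z = F z - q z := by linarith
  rw [h4] at h1
  have h5 := abs_le.1 hε
  have h6 : 0 < Real.sin z * q z := mul_pos hs hq0
  have h7 : f z * (6 * q z) ≤ f z * q' := mul_le_mul_of_nonneg_left hK (by linarith)
  have h8 : 2 / 5 * Real.sin z * q z ≤ f z * q z := mul_le_mul_of_nonneg_right h3 hq0.le
  have h9 : (f z - q') ^ 2 ≤ (f z - q') * f z := by
    nlinarith [mul_nonneg hnn (show 0 ≤ q' by linarith)]
  nlinarith [mul_le_mul_of_nonneg_right h5.1 h6.le]

end RisingBranch

lemma ViscSuper.of_isLocalMin {ε : ℝ} {v : ℝ → ℝ} (h : ViscSuper ε v) {x : ℝ}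
    (hx : IsLocalMin v x) : 2 * Real.sin x * (2 * Real.sin x - ε * v x) ≤ 0 := by
  simpa using h (fun _ => 0) x 0 contDiffAt_const (hasDerivAt_const x 0) (by simpa using hx)

/-- On the half circle where the equation is not proper, a solution has no interior
global minimum in the second quarter. -/
lemma not_isMinOn_of_pi_div_two_le {v : ℝ → ℝ} (hv : Continuous v) (hvpi : v Real.pi = 0)
    (hsub : ViscSub (-1) v) {x : ℝ} (hx : x ∈ Ico (Real.pi / 2) Real.pi)
    (hmin : ∀ y ∈ Icc 0 Real.pi, v x ≤ v y) : v x ≠ -(2 * Real.sin x) := by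
  intro hvx
  have hx0 : 0 < x := lt_of_lt_of_le (by positivity) hx.1
  set κ := √(1 / 2 : ℝ) with hκ
  have hκ2 : κ ^ 2 = 1 / 2 := Real.sq_sqrt (by norm_num)
  have hκ0 : 0 < κ := by positivity
  have hle : ∀ t ∈ Icc x Real.pi, √(v t - v x) ≤ κ * (t - x) := by
    refine RisingBranch.le_on_Icc_of_Ioo hx.2 (by fun_prop) (by fun_prop) fun t ht => ?_
    by_contra! hlt
    obtain ⟨z, hz, q, q', hq, hq', hq0, hK, hzq, hle⟩ := exists_touching_above
      (g := fun t => √(v t - v x) - κ * (t - x)) 1 (by fun_prop) (by simp) ht (sub_pos.2 hlt)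
    have hwz : √(v z - v x) = κ * (z - x) + q z := by linarith
    have hvz : 0 ≤ v z - v x := sub_nonneg.2 (hmin z ⟨by linarith [hz.1], hz.2.le⟩)
    have hvz' : v z - v x = (κ * (z - x) + q z) ^ 2 := by rw [← hwz, Real.sq_sqrt hvz]
    have hd : HasDerivAt (fun y => (κ * (y - x) + q y) ^ 2)
        (2 * (κ * (z - x) + q z) * (κ + q')) z := by
      refine (((((hasDerivAt_id z).sub_const x).const_mul κ).add hq').pow 2).congr_deriv ?_
      simp
    have h1 := hsub (fun y => (κ * (y - x) + q y) ^ 2) z _ (((contDiffAt_const.mul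
      (contDiffAt_id.sub contDiffAt_const)).add hq).pow 2) hd (by
        filter_upwards [hle, Ioo_mem_nhds hz.1 hz.2] with y hy hyI
        have hvy : 0 ≤ v y - v x := sub_nonneg.2 (hmin y ⟨by linarith [hyI.1], hyI.2.le⟩)
        have : v y - v x ≤ (κ * (y - x) + q y) ^ 2 := by
          rw [← Real.sq_sqrt hvy]
          exact pow_le_pow_left₀ (Real.sqrt_nonneg _) (by linarith) 2
        linarith)
    have hsz : 0 ≤ Real.sin z := Real.sin_nonneg_of_nonneg_of_le_pi (by linarith [hz.1]) hz.2.le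
    have hszx : Real.sin z ≤ Real.sin x := by
      rw [← Real.sin_pi_sub z, ← Real.sin_pi_sub x]
      exact Real.sin_le_sin_of_le_of_le_pi_div_two (by linarith [hz.2, Real.pi_pos])
        (by linarith [hx.1]) (by linarith [hz.1])
    set w := κ * (z - x) + q z with hw
    have hw0 : 0 < w := add_pos (mul_pos hκ0 (sub_pos.2 hz.1)) hq0
    have hbound : 2 * Real.sin z * (2 * Real.sin z - -1 * v z) ≤ 2 * w ^ 2 := by
      nlinarith [mul_nonneg hsz (sub_nonneg.2 hszx), Real.sin_le_one z, sq_nonneg w]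
    have : 2 * w ^ 2 < (2 * w * (κ + q')) ^ 2 := by
      have : 1 / 2 < (κ + q') ^ 2 := by nlinarith
      nlinarith [mul_pos hw0 hw0]
    linarith
  have h1 := hle Real.pi (right_mem_Icc.2 hx.2.le)
  have h2 : v Real.pi - v x ≤ (κ * (Real.pi - x)) ^ 2 := Real.sqrt_le_left (by
    exact mul_nonneg hκ0.le (sub_nonneg.2 hx.2.le)) |>.1 h1
  rw [hvpi, hvx, mul_pow, hκ2, ← Real.sin_pi_sub x] at h2
  set t := Real.pi - x with ht
  have ht0 : 0 < t := sub_pos.2 hx.2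
  have htpi : t ≤ Real.pi / 2 := by linarith [hx.1]
  have h3 := Real.mul_le_sin ht0.le htpi
  have h4 : 1 / 2 ≤ 2 / Real.pi := by
    rw [div_le_div_iff₀ (by norm_num) Real.pi_pos]; linarith [Real.pi_le_four]
  have h5 : t < 1.6 := by linarith [Real.pi_lt_d2]
  nlinarith [mul_le_mul_of_nonneg_right h4 ht0.le]

lemma nonneg_of_visc {v : ℝ → ℝ} (hv : Continuous v) (hv0 : v 0 = 0) (hvpi : v Real.pi = 0)
    (hsub : ViscSub (-1) v) (hsuper : ViscSuper (-1) v) : ∀ y ∈ Icc 0 Real.pi, 0 ≤ v y := by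
  obtain ⟨x, hx, hmin⟩ := (isCompact_Icc (a := 0) (b := Real.pi)).exists_isMinOn
    ⟨0, by simp [Real.pi_pos.le]⟩ hv.continuousOn
  have hmin : ∀ y ∈ Icc 0 Real.pi, v x ≤ v y := fun y hy => hmin hy
  intro y hy
  refine le_trans ?_ (hmin y hy)
  rcases hx.1.eq_or_lt with rfl | hx0
  · exact hv0.ge
  rcases hx.2.eq_or_lt with rfl | hxpi
  · exact hvpi.ge
  exfalso
  have hs : 0 < Real.sin x := Real.sin_pos_of_pos_of_lt_pi hx0 hxpi
  have h1 := hsuper.of_isLocalMin (Filter.mem_of_superset (Icc_mem_nhds hx0 hxpi) hmin)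
  have h2 := hsub.hamiltonian_nonneg hv x
  have hvx : v x = -(2 * Real.sin x) := by
    have : 2 * Real.sin x * (2 * Real.sin x - -1 * v x) = 0 := le_antisymm h1 h2
    have := (mul_eq_zero.1 this).resolve_left (by positivity)
    linarith
  rcases le_or_gt (Real.pi / 2) x with h | h
  · exact not_isMinOn_of_pi_div_two_le hv hvpi hsub ⟨h, hxpi⟩ hmin hvx
  · refine not_isMinOn_of_pi_div_two_le (v := fun y => v (Real.pi - y)) (x := Real.pi - x)
      (by fun_prop) (by simpa using hv0) hsub.comp_pi_sub ⟨by linarith, by linarith⟩ ?_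
      (by simpa using hvx)
    intro y hy
    simpa using hmin (Real.pi - y) ⟨by linarith [hy.2], by linarith [hy.1]⟩

lemma not_isLocalMin_sin {x : ℝ} (hx : x ∈ Ioo 0 Real.pi) : ¬ IsLocalMin Real.sin x := by
  intro h
  obtain ⟨R, hR, hball⟩ := Metric.eventually_nhds_iff_ball.1 h
  set δ := min (R / 2) 1 with hδ
  have hδ0 : 0 < δ := by positivity
  have hδR : δ < R := (min_le_left _ _).trans_lt (by linarith)
  have h1 := hball (x + δ) (by simpa [abs_of_pos hδ0] using hδR)
  have h2 := hball (x - δ) (by simpa [abs_of_pos hδ0, Real.dist_eq] using hδR)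
  rw [Real.sin_add] at h1
  rw [Real.sin_sub] at h2
  have hs := Real.sin_pos_of_pos_of_lt_pi hx.1 hx.2
  have hc : Real.cos δ < 1 := by
    have := Real.cos_lt_cos_of_nonneg_of_le_pi le_rfl
      ((min_le_right _ _).trans (by linarith [Real.pi_gt_three])) hδ0
    simpa using this
  nlinarith

lemma not_isLocalMin_of_visc {ε : ℝ} (hε : ε = 1 ∨ ε = -1) {v : ℝ → ℝ} (hv : Continuous v)
    (hv0 : v 0 = 0) (hvpi : v Real.pi = 0) (hsub : ViscSub ε v) (hsuper : ViscSuper ε v) {x : ℝ}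
    (hx : x ∈ Ioo 0 Real.pi) : ¬ IsLocalMin v x := by
  intro hmin
  have hs : 0 < Real.sin x := Real.sin_pos_of_pos_of_lt_pi hx.1 hx.2
  have h1 := hsuper.of_isLocalMin hmin
  have h2 : 2 * Real.sin x ≤ ε * v x := by
    have := nonpos_of_mul_nonpos_right h1 (by positivity)
    linarith
  rcases hε with rfl | rfl
  · refine not_isLocalMin_sin hx ?_
    filter_upwards [hmin, Ioo_mem_nhds hx.1 hx.2] with y hy hyI
    have h3 := nonneg_of_mul_nonneg_right (hsub.hamiltonian_nonneg hv y)
      (mul_pos two_pos (Real.sin_pos_of_pos_of_lt_pi hyI.1 hyI.2))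
    linarith
  · linarith [nonneg_of_visc hv hv0 hvpi hsub hsuper x (Ioo_subset_Icc_self hx)]

lemma monotoneOn_of_not_isLocalMin {v : ℝ → ℝ} (hv : Continuous v) {c m : ℝ}
    (hno : ∀ x ∈ Ioo c m, ¬ IsLocalMin v x) (hmax : ∀ y ∈ Icc c m, v y ≤ v m) :
    MonotoneOn v (Icc c m) := by
  intro a ha b hb hab
  by_contra! hlt
  obtain ⟨x, hx, hmin⟩ := (isCompact_Icc (a := a) (b := m)).exists_isMinOn
    ⟨b, hab, hb.2⟩ hv.continuousOn
  have hxb : v x ≤ v b := hmin ⟨hab, hb.2⟩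
  have hax : a < x := lt_of_le_of_ne hx.1 (by rintro rfl; linarith)
  have hxm : x < m := lt_of_le_of_ne hx.2 (by rintro rfl; linarith [hmax a ha])
  exact hno x ⟨ha.1.trans_lt hax, hxm⟩ (hmin.isLocalMin (Icc_mem_nhds hax hxm))

namespace RisingBranch

variable {ε : ℝ} {F f v : ℝ → ℝ}

/-- A viscosity solution vanishing at the ends of the half circle is the rising branch on the
first quarter. -/
lemma eq_of_visc (h : RisingBranch ε F f) (hε : ε = 1 ∨ ε = -1) (hv : Continuous v)
    (hv0 : v 0 = 0) (hvpi : v Real.pi = 0) (hsub : ViscSub ε v) (hsuper : ViscSuper ε v) :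
    ∀ t ∈ Icc 0 (Real.pi / 2), v t = F t := by
  have hε' : |ε| ≤ 1 := by rcases hε with rfl | rfl <;> simp
  have hpi := Real.pi_pos
  intro t ht
  refine le_antisymm (h.le_of_viscSub hε' hv hv0 hsub t ht) ?_
  obtain ⟨m, hm, hmax⟩ := (isCompact_Icc (a := 0) (b := Real.pi)).exists_isMaxOn
    ⟨0, by simp [hpi.le]⟩ hv.continuousOn
  have hmax : ∀ y ∈ Icc 0 Real.pi, v y ≤ v m := fun y hy => hmax hy
  have hmono : MonotoneOn v (Icc 0 m) := monotoneOn_of_not_isLocalMin hv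
    (fun x hx => not_isLocalMin_of_visc hε hv hv0 hvpi hsub hsuper ⟨hx.1, hx.2.trans_le hm.2⟩)
    fun y hy => hmax y ⟨hy.1, hy.2.trans hm.2⟩
  rcases le_total (Real.pi / 2) m with hmp | hmp
  · exact h.le_of_viscSuper hε' hv hv0 hsuper le_rfl
      (hmono.mono (Icc_subset_Icc_right hmp)) t ht
  rcases le_total t m with htm | htm
  · exact h.le_of_viscSuper hε' hv hv0 hsuper hmp hmono t ⟨ht.1, htm⟩
  have hw : Continuous fun x => v (Real.pi - x) := by fun_prop
  have hmonow : MonotoneOn (fun x => v (Real.pi - x)) (Icc 0 (Real.pi - m)) :=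
    monotoneOn_of_not_isLocalMin hw
      (fun x hx => not_isLocalMin_of_visc hε hw (by simpa using hvpi) (by simpa using hv0)
        hsub.comp_pi_sub hsuper.comp_pi_sub ⟨hx.1, by linarith [hx.2, hm.1]⟩)
      fun y hy => by
        simpa using hmax (Real.pi - y) ⟨by linarith [hy.2, hm.1], by linarith [hy.1]⟩
  have hhalf := h.le_of_viscSuper hε' hw (by simpa using hvpi) hsuper.comp_pi_sub le_rfl
    (hmonow.mono (Icc_subset_Icc_right (by linarith))) (Real.pi / 2) ⟨by positivity, le_rfl⟩
  have h1 := h.monotoneOn ht ⟨by positivity, le_rfl⟩ ht.2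
  have h2 := hmonow (a := Real.pi / 2) (b := Real.pi - t) ⟨by positivity, by linarith⟩
    ⟨by linarith [ht.2], by linarith⟩ (by linarith [ht.2])
  simp only [sub_sub_cancel] at h2
  linarith

end RisingBranch

lemma abs_sqrt_max_sub_sqrt_max_le {A B c : ℝ} (hc : 0 < c) :
    |√(max A (c ^ 2)) - √(max B (c ^ 2))| ≤ |A - B| / (2 * c) := by
  have hA : c ≤ √(max A (c ^ 2)) := Real.le_sqrt_of_sq_le (le_max_right _ _)
  have hB : c ≤ √(max B (c ^ 2)) := Real.le_sqrt_of_sq_le (le_max_right _ _)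
  have hA2 := Real.sq_sqrt ((sq_nonneg c).trans (le_max_right A (c ^ 2)))
  have hB2 := Real.sq_sqrt ((sq_nonneg c).trans (le_max_right B (c ^ 2)))
  have hmax := abs_max_sub_max_le_abs A B (c ^ 2)
  set a := √(max A (c ^ 2))
  set b := √(max B (c ^ 2))
  rw [le_div_iff₀ (by positivity)]
  refine le_trans ?_ hmax
  rw [← hA2, ← hB2, show a ^ 2 - b ^ 2 = (a - b) * (a + b) by ring, abs_mul]
  exact mul_le_mul_of_nonneg_left (by rw [abs_of_nonneg] <;> linarith) (abs_nonneg _)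

/-- The slope of the rising branch, truncated away from the degenerate set. -/
def truncatedSlope (ε t y : ℝ) : ℝ :=
  √(max (2 * Real.sin t * (2 * Real.sin t - ε * y)) ((2 / 5 * Real.sin t) ^ 2))

lemma continuous_truncatedSlope (ε : ℝ) :
    Continuous fun z : ℝ × ℝ => truncatedSlope ε z.1 z.2 := by
  unfold truncatedSlope
  fun_prop

lemma sin_nonneg_of_mem {t : ℝ} (ht : t ∈ Icc 0 (Real.pi / 2)) : 0 ≤ Real.sin t :=
  Real.sin_nonneg_of_nonneg_of_le_pi ht.1 (by linarith [ht.2, Real.pi_pos])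

lemma exists_truncated_solution {ε : ℝ} (hε : |ε| ≤ 1) :
    ∃ F : ℝ → ℝ, F 0 = 0 ∧ ∀ t ∈ Icc 0 (Real.pi / 2),
      HasDerivWithinAt F (truncatedSlope ε t (F t)) (Icc 0 (Real.pi / 2)) t := by
  have hpi := Real.pi_pos
  have hPL : IsPicardLindelof (truncatedSlope ε) (tmin := 0) (tmax := Real.pi / 2)
      ⟨0, by constructor <;> positivity⟩ 0 10 0 5 3 := by
    refine ⟨fun t ht => ?_, fun y _ => ?_, fun t ht y hy => ?_, ?_⟩
    · refine LipschitzOnWith.of_dist_le_mul fun y _ z _ => ?_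
      rw [Real.dist_eq, Real.dist_eq]
      rcases (sin_nonneg_of_mem ht).eq_or_lt with h0 | h0
      · simp [truncatedSlope, ← h0]
      refine (abs_sqrt_max_sub_sqrt_max_le (by positivity)).trans ?_
      rw [div_le_iff₀ (by positivity), show 2 * Real.sin t * (2 * Real.sin t - ε * y) -
        2 * Real.sin t * (2 * Real.sin t - ε * z) = -(2 * Real.sin t * (ε * (y - z))) by ring,
        abs_neg, abs_mul, abs_mul ε, abs_of_pos (by positivity : 0 < 2 * Real.sin t)]
      have := mul_le_mul_of_nonneg_right hε (abs_nonneg (y - z))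
      have := mul_nonneg h0.le (abs_nonneg (y - z))
      push_cast
      nlinarith
    · exact ((continuous_truncatedSlope ε).comp (by fun_prop : Continuous fun t : ℝ => (t, y)))
        |>.continuousOn
    · have hs := sin_nonneg_of_mem ht
      have hs1 := Real.sin_le_one t
      have hy' : |y| ≤ 10 := by simpa using hy
      have hεy : |ε * y| ≤ 10 := by
        rw [abs_mul]
        nlinarith [abs_nonneg ε, abs_nonneg y]
      have := abs_le.1 hεy
      rw [truncatedSlope, Real.norm_of_nonneg (Real.sqrt_nonneg _)]
      refine Real.sqrt_le_iff.2 ⟨by norm_num, max_le ?_ ?_⟩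
      · push_cast
        nlinarith
      · push_cast
        nlinarith
    · simp only [sub_zero, sub_self, NNReal.coe_zero]
      rw [max_eq_left (by positivity)]
      push_cast
      linarith [Real.pi_lt_d2]
  simpa using hPL.exists_eq_forall_mem_Icc_hasDerivWithinAt₀

/-- An explicit barrier keeping the rising branch away from the degenerate set. -/
lemma barrier_le {t : ℝ} (ht : t ∈ Icc 0 (Real.pi / 2)) :
    9 / 10 * Real.sin t - 8 / 5 * Real.cos t + 8 / 5 * Real.exp (-(t / 2)) ≤
      48 / 25 * Real.sin t := by
  have hpi := Real.pi_pos
  have h1 := Real.mul_le_sin ht.1 ht.2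
  have h2 := Real.one_sub_mul_le_cos ht.1 ht.2
  have h3 : 2 / Real.pi * t ≤ 2 / 3 * t :=
    mul_le_mul_of_nonneg_right
      (div_le_div_of_nonneg_left (by norm_num) (by norm_num) Real.pi_gt_three.le) ht.1
  have h4 : Real.exp (-(t / 2)) ≤ 1 - t / 4 := by
    have h5 := Real.add_one_le_exp (t / 2)
    have h6 : Real.exp (-(t / 2)) * Real.exp (t / 2) = 1 := by
      rw [← Real.exp_add, neg_add_cancel, Real.exp_zero]
    have h7 : t < 1.6 := by linarith [ht.2, Real.pi_lt_d2]
    have h8 : 1 ≤ (1 - t / 4) * (1 + t / 2) := by nlinarith [ht.1]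
    refine le_of_mul_le_mul_right ?_ (Real.exp_pos (t / 2))
    rw [h6]
    exact h8.trans (mul_le_mul_of_nonneg_left (by linarith) (by linarith))
  linarith [ht.1]

lemma truncated_solution_le {F : ℝ → ℝ} (h0 : F 0 = 0)
    (hF : ∀ t ∈ Icc 0 (Real.pi / 2),
      HasDerivWithinAt F (truncatedSlope 1 t (F t)) (Icc 0 (Real.pi / 2)) t) :
    ∀ t ∈ Icc 0 (Real.pi / 2), F t ≤ 48 / 25 * Real.sin t := by
  intro t ht
  refine (image_le_of_deriv_right_lt_deriv_boundary
    (B := fun t => 9 / 10 * Real.sin t - 8 / 5 * Real.cos t + 8 / 5 * Real.exp (-(t / 2)))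
    (B' := fun t => 9 / 10 * Real.cos t + 8 / 5 * Real.sin t - 4 / 5 * Real.exp (-(t / 2)))
    (fun t ht => (hF t ht).continuousWithinAt)
    (fun t ht => (hF t (Ico_subset_Icc_self ht)).mono_of_mem_nhdsWithin
      (Icc_mem_nhdsGE_of_mem ht)) (by simp [h0]) (fun t => ?_) (fun t ht heq => ?_) ht).trans
    (barrier_le ht)
  · have h1 : HasDerivAt (fun t : ℝ => Real.exp (-(t / 2))) (Real.exp (-(t / 2)) * -(1 / 2)) t := by
      simpa using ((hasDerivAt_id t).div_const 2).neg.exp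
    refine ((((Real.hasDerivAt_sin t).const_mul (9 / 10)).sub
      ((Real.hasDerivAt_cos t).const_mul (8 / 5))).add (h1.const_mul (8 / 5))).congr_deriv ?_
    ring
  · have ht' := Ico_subset_Icc_self ht
    have hs := sin_nonneg_of_mem ht'
    have hc : 0 < Real.cos t :=
      Real.cos_pos_of_mem_Ioo ⟨by linarith [ht.1, Real.pi_pos], ht.2⟩
    have hb := barrier_le ht'
    have hle : truncatedSlope 1 t (F t) ≤ 2 * Real.sin t - F t / 2 := by
      refine Real.sqrt_le_iff.2 ⟨by linarith, max_le ?_ ?_⟩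
      · nlinarith [sq_nonneg (F t)]
      · exact pow_le_pow_left₀ (by positivity) (by linarith) 2
    linarith

lemma exists_risingBranch {ε : ℝ} (hε : ε = 1 ∨ ε = -1) :
    ∃ F f : ℝ → ℝ, RisingBranch ε F f := by
  have hpi : (0 : ℝ) ≤ Real.pi / 2 := by positivity
  obtain ⟨G, hG0, hG⟩ := exists_truncated_solution (ε := ε)
    (by rcases hε with rfl | rfl <;> simp)
  have hGc : ContinuousOn G (Icc 0 (Real.pi / 2)) := fun t ht => (hG t ht).continuousWithinAt
  have hmono : MonotoneOn G (Icc 0 (Real.pi / 2)) := by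
    refine monotoneOn_of_deriv_nonneg (convex_Icc _ _) hGc ?_ ?_ <;> rw [interior_Icc]
    · exact fun t ht => ((hG t (Ioo_subset_Icc_self ht)).mono
        Ioo_subset_Icc_self).differentiableWithinAt
    · intro t ht
      rw [((hG t (Ioo_subset_Icc_self ht)).hasDerivAt (Icc_mem_nhds ht.1 ht.2)).deriv]
      exact Real.sqrt_nonneg _
  have hA : ∀ t ∈ Icc 0 (Real.pi / 2),
      (2 / 5 * Real.sin t) ^ 2 ≤ 2 * Real.sin t * (2 * Real.sin t - ε * G t) := by
    intro t ht
    have hs := sin_nonneg_of_mem ht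
    have hle : ε * G t ≤ 48 / 25 * Real.sin t := by
      rcases hε with rfl | rfl
      · simpa using truncated_solution_le hG0 hG t ht
      · have := hmono (left_mem_Icc.2 hpi) ht ht.1
        linarith
    nlinarith
  set F : ℝ → ℝ := IccExtend hpi ((Icc 0 (Real.pi / 2)).domRestrict G) with hFdef
  have hFG : ∀ t ∈ Icc 0 (Real.pi / 2), F t = G t := fun t ht => by
    rw [hFdef, IccExtend_of_mem hpi _ ht, domRestrict_apply]
  have hFc : Continuous F := hGc.domRestrict.Icc_extend'
  refine ⟨F, fun t => truncatedSlope ε t (F t), hFc, ?_, fun t ht => ?_, ?_, fun t ht => ?_,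
    fun t ht => ?_⟩
  · rw [hFG 0 (left_mem_Icc.2 hpi), hG0]
  · rw [hFG t ht]
    exact (hG t ht).congr hFG (hFG t ht)
  · exact ((continuous_truncatedSlope ε).comp
      (by fun_prop : Continuous fun t : ℝ => (t, F t))).continuousOn
  · simp only [truncatedSlope]
    rw [hFG t ht, max_eq_left (hA t ht), Real.sq_sqrt ((sq_nonneg _).trans (hA t ht))]
  · exact Real.le_sqrt_of_sq_le (le_max_right _ _)

/-- `v` has one-sided derivatives at `x` forming a concave corner, both solving the equation. -/
def ConcaveCorner (ε : ℝ) (v : ℝ → ℝ) (x : ℝ) : Prop :=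
  ∃ l r : ℝ, HasDerivWithinAt v l (Iic x) x ∧ HasDerivWithinAt v r (Ici x) x ∧ r ≤ l ∧
    l ^ 2 = 2 * Real.sin x * (2 * Real.sin x - ε * v x) ∧
    r ^ 2 = 2 * Real.sin x * (2 * Real.sin x - ε * v x)

namespace ConcaveCorner

lemma circleSubsol {v : ℝ → ℝ} (h : ∀ x, ConcaveCorner 1 v x) : CircleSubsol v := by
  intro ψ hψ x hmax
  obtain ⟨l, r, hl, hr, -, hl2, hr2⟩ := h x
  have hd := ((hψ.differentiable one_ne_zero) x).hasDerivAt
  have h1 := (hmax.on (Iic x)).left_deriv_nonneg (hl.sub hd.hasDerivWithinAt)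
  have h2 := (hmax.on (Ici x)).right_deriv_nonpos (hr.sub hd.hasDerivWithinAt)
  rw [Real.cos_two_mul, Real.cos_sq']
  rcases le_total 0 (deriv ψ x) with h0 | h0 <;> nlinarith

lemma circleSupersol {v : ℝ → ℝ} (h : ∀ x, ConcaveCorner 1 v x) : CircleSupersol v := by
  intro ψ hψ x hmin
  obtain ⟨l, r, hl, hr, hrl, hl2, hr2⟩ := h x
  have hd := ((hψ.differentiable one_ne_zero) x).hasDerivAt
  have hmax : IsLocalMax (fun y => ψ y - v y) x := by
    simpa using hmin.neg
  have h1 := (hmax.on (Iic x)).left_deriv_nonneg (hd.hasDerivWithinAt.sub hl)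
  have h2 := (hmax.on (Ici x)).right_deriv_nonpos (hd.hasDerivWithinAt.sub hr)
  have h3 : deriv ψ x = l := by linarith
  rw [Real.cos_two_mul, Real.cos_sq', h3]
  linarith

lemma of_comp_neg {ε : ℝ} {v : ℝ → ℝ} {x : ℝ}
    (h : ConcaveCorner (-ε) (fun y => v (-y)) (-x)) : ConcaveCorner ε v x := by
  obtain ⟨l, r, hl, hr, hrl, hl2, hr2⟩ := h
  refine ⟨-r, -l, ?_, ?_, by linarith, ?_, ?_⟩
  · have := HasDerivWithinAt.scomp (t' := Ici (-x)) x hr (hasDerivAt_neg x).hasDerivWithinAt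
      (s := Iic x) (fun y hy => neg_le_neg (mem_Iic.1 hy))
    simpa [Function.comp_def] using this
  · have := HasDerivWithinAt.scomp (t' := Iic (-x)) x hl (hasDerivAt_neg x).hasDerivWithinAt
      (s := Ici x) (fun y hy => neg_le_neg (mem_Ici.1 hy))
    simpa [Function.comp_def] using this
  · simp only [Real.sin_neg, neg_neg] at hr2
    linarith
  · simp only [Real.sin_neg, neg_neg] at hl2
    linarith

lemma of_comp_pi_sub {ε : ℝ} {v : ℝ → ℝ} {x : ℝ}
    (h : ConcaveCorner ε (fun y => v (Real.pi - y)) (Real.pi - x)) : ConcaveCorner ε v x := by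
  obtain ⟨l, r, hl, hr, hrl, hl2, hr2⟩ := h
  have hd : HasDerivAt (fun y => Real.pi - y) (-1) x := by
    simpa using (hasDerivAt_id x).const_sub Real.pi
  refine ⟨-r, -l, ?_, ?_, by linarith, ?_, ?_⟩
  · have := HasDerivWithinAt.scomp (t' := Ici (Real.pi - x)) x hr hd.hasDerivWithinAt
      (s := Iic x) (fun y hy => sub_le_sub_left (mem_Iic.1 hy) _)
    simpa [Function.comp_def] using this
  · have := HasDerivWithinAt.scomp (t' := Iic (Real.pi - x)) x hl hd.hasDerivWithinAt
      (s := Ici x) (fun y hy => sub_le_sub_left (mem_Ici.1 hy) _)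
    simpa [Function.comp_def] using this
  · simp only [Real.sin_pi_sub, sub_sub_cancel] at hr2
    linarith
  · simp only [Real.sin_pi_sub, sub_sub_cancel] at hl2
    linarith

lemma of_sub_const {ε : ℝ} {v : ℝ → ℝ} {x c : ℝ} (h : ConcaveCorner ε v (x - c))
    (hv : ∀ y, v (y - c) = v y) (hsin : Real.sin (x - c) = Real.sin x) : ConcaveCorner ε v x := by
  obtain ⟨l, r, hl, hr, hrl, hl2, hr2⟩ := h
  have hd : HasDerivAt (fun y => y - c) 1 x := (hasDerivAt_id x).sub_const c
  rw [hsin, hv] at hl2 hr2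
  refine ⟨l, r, ?_, ?_, hrl, hl2, hr2⟩
  · have := HasDerivWithinAt.scomp (t' := Iic (x - c)) x hl hd.hasDerivWithinAt
      (s := Iic x) (fun y hy => sub_le_sub_right (mem_Iic.1 hy) _)
    simpa [Function.comp_def, hv] using this
  · have := HasDerivWithinAt.scomp (t' := Ici (x - c)) x hr hd.hasDerivWithinAt
      (s := Ici x) (fun y hy => sub_le_sub_right (mem_Ici.1 hy) _)
    simpa [Function.comp_def, hv] using this

end ConcaveCorner

namespace RisingBranch

variable {ε : ℝ} {F f v : ℝ → ℝ}

lemma hasDerivWithinAt_Ici (h : RisingBranch ε F f)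
    (hvF : ∀ t ∈ Icc 0 (Real.pi / 2), v t = F t) {t : ℝ} (ht : t ∈ Ico 0 (Real.pi / 2)) :
    HasDerivWithinAt v (f t) (Ici t) t := by
  have ht' := Ico_subset_Icc_self ht
  exact ((h.deriv t ht').congr hvF (hvF t ht')).mono_of_mem_nhdsWithin (Icc_mem_nhdsGE_of_mem ht)

lemma hasDerivWithinAt_Iic (h : RisingBranch ε F f)
    (hvF : ∀ t ∈ Icc 0 (Real.pi / 2), v t = F t) {t : ℝ} (ht : t ∈ Ioc 0 (Real.pi / 2)) :
    HasDerivWithinAt v (f t) (Iic t) t := by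
  have ht' := Ioc_subset_Icc_self ht
  exact ((h.deriv t ht').congr hvF (hvF t ht')).mono_of_mem_nhdsWithin (Icc_mem_nhdsLE_of_mem ht)

lemma concaveCorner (h : RisingBranch ε F f) (hvF : ∀ t ∈ Icc 0 (Real.pi / 2), v t = F t)
    (hsymm : ∀ t, v (Real.pi - t) = v t) {t : ℝ} (ht : t ∈ Ioc 0 (Real.pi / 2)) :
    ConcaveCorner ε v t := by
  have ht' := Ioc_subset_Icc_self ht
  have hsq := h.sq t ht'
  rw [← hvF t ht'] at hsq
  have hl := h.hasDerivWithinAt_Iic hvF ht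
  rcases ht.2.eq_or_lt with rfl | hlt
  · have hf : 0 ≤ f (Real.pi / 2) := by
      have := h.lower _ ht'
      rw [Real.sin_pi_div_two] at this
      linarith
    refine ⟨f (Real.pi / 2), -f (Real.pi / 2), hl, ?_, by linarith, hsq, by rw [neg_sq, hsq]⟩
    have hd : HasDerivAt (fun y => Real.pi - y) (-1) (Real.pi / 2) := by
      simpa using (hasDerivAt_id (Real.pi / 2)).const_sub Real.pi
    have hhalf : Real.pi - Real.pi / 2 = Real.pi / 2 := by ring
    have := HasDerivWithinAt.scomp (t' := Iic (Real.pi / 2)) (Real.pi / 2) (by rwa [hhalf])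
      hd.hasDerivWithinAt (s := Ici (Real.pi / 2))
      (fun y hy => by have := mem_Ici.1 hy; exact mem_Iic.2 (by linarith))
    simpa [Function.comp_def, hsymm] using this
  · exact ⟨f t, f t, hl, h.hasDerivWithinAt_Ici hvF ⟨ht.1.le, hlt⟩, le_rfl, hsq, hsq⟩

end RisingBranch

lemma exists_circleSolution : ∃ u : ℝ → ℝ, CircleSolution u := by
  obtain ⟨F, f, hF⟩ := exists_risingBranch (Or.inl rfl)
  obtain ⟨G, g, hG⟩ := exists_risingBranch (Or.inr rfl)
  have hpi := Real.pi_pos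
  set u : ℝ → ℝ := fun x =>
    F (max (Real.arcsin (Real.sin x)) 0) + G (max (-Real.arcsin (Real.sin x)) 0) with hu
  have hFc := hF.cont
  have hGc := hG.cont
  have huF : ∀ t ∈ Icc 0 (Real.pi / 2), u t = F t := fun t ht => by
    have : Real.arcsin (Real.sin t) = t := Real.arcsin_sin (by linarith [ht.1]) ht.2
    simp only [hu, this]
    rw [max_eq_left ht.1, max_eq_right (neg_nonpos.2 ht.1), hG.zero, add_zero]
  have huG : ∀ t ∈ Icc 0 (Real.pi / 2), u (-t) = G t := fun t ht => by
    have : Real.arcsin (Real.sin t) = t := Real.arcsin_sin (by linarith [ht.1]) ht.2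
    simp only [hu, Real.sin_neg, Real.arcsin_neg, this, neg_neg]
    rw [max_eq_left ht.1, max_eq_right (neg_nonpos.2 ht.1), hF.zero, zero_add]
  have hsymm : ∀ t, u (Real.pi - t) = u t := fun t => by simp only [hu, Real.sin_pi_sub]
  have hper : Function.Periodic u (2 * Real.pi) := fun t => by
    simp only [hu, Real.sin_add_two_pi]
  have hsymm' : ∀ t, u (-(Real.pi - t)) = u (-t) := fun t => by
    simp only [hu, Real.sin_neg, Real.sin_pi_sub]
  have hnear : ∀ t ∈ Icc (-(Real.pi / 2)) (Real.pi / 2), ConcaveCorner 1 u t := by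
    intro t ht
    rcases lt_trichotomy t 0 with h0 | rfl | h0
    · exact .of_comp_neg (hG.concaveCorner huG hsymm' ⟨by linarith, by linarith [ht.1]⟩)
    · have hz : (0 : ℝ) ∈ Ico 0 (Real.pi / 2) := ⟨le_rfl, by positivity⟩
      have hf0 : f 0 = 0 := by simpa using hF.sq 0 (Ico_subset_Icc_self hz)
      have hg0 : g 0 = 0 := by simpa using hG.sq 0 (Ico_subset_Icc_self hz)
      have h1 := hF.hasDerivWithinAt_Ici huF hz
      have h2 := hG.hasDerivWithinAt_Ici (v := fun y => u (-y)) huG hz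
      rw [hf0] at h1
      rw [hg0] at h2
      refine ⟨0, 0, ?_, h1, le_rfl, by simp, by simp⟩
      have := HasDerivWithinAt.scomp (t' := Ici (0 : ℝ)) 0 (by simpa using h2)
        (hasDerivAt_neg (0 : ℝ)).hasDerivWithinAt (s := Iic 0)
        (fun y hy => neg_nonneg.2 (mem_Iic.1 hy))
      simpa [Function.comp_def] using this
    · exact hF.concaveCorner huF hsymm ⟨h0, ht.2⟩
  have hcorner : ∀ x, ConcaveCorner 1 u x := by
    intro x
    obtain ⟨n, hn, -⟩ := existsUnique_sub_zsmul_mem_Ico Real.two_pi_pos x (-(Real.pi / 2))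
    have hshift : ConcaveCorner 1 u (x - n • (2 * Real.pi)) := by
      rcases le_or_gt (x - n • (2 * Real.pi)) (Real.pi / 2) with h | h
      · exact hnear _ ⟨hn.1, h⟩
      · refine .of_comp_pi_sub ?_
        simp only [hsymm]
        exact hnear _ ⟨by linarith [hn.2], by linarith⟩
    refine hshift.of_sub_const (fun y => hper.sub_zsmul_eq n) ?_
    exact Real.sin_periodic.sub_zsmul_eq n
  exact ⟨u, by fun_prop, hper, ConcaveCorner.circleSubsol hcorner, ConcaveCorner.circleSupersol hcorner⟩

namespace CircleSolution

variable {u : ℝ → ℝ}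

lemma eq_zero (h : CircleSolution u) : u 0 = 0 ∧ u Real.pi = 0 ∧ u (-Real.pi) = 0 := by
  obtain ⟨hc, hper, hsub, -⟩ := h
  have hpi := Real.pi_pos
  have hup : ∀ t ∈ Icc 0 Real.pi, u t ≤ 2 * Real.sin t :=
    RisingBranch.le_on_Icc_of_Ioo hpi hc (by fun_prop) fun t ht => by
      have := nonneg_of_mul_nonneg_right (hsub.viscSub.hamiltonian_nonneg hc t)
        (mul_pos two_pos (Real.sin_pos_of_pos_of_lt_pi ht.1 ht.2))
      linarith
  have hlow : ∀ t ∈ Icc (-Real.pi) 0, 2 * Real.sin t ≤ u t :=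
    RisingBranch.le_on_Icc_of_Ioo (by linarith) (by fun_prop) hc fun t ht => by
      have hs := Real.sin_neg_of_neg_of_neg_pi_lt ht.2 ht.1
      by_contra! hlt
      nlinarith [hsub.viscSub.hamiltonian_nonneg hc t]
  have h1 := hup 0 ⟨le_rfl, hpi.le⟩
  have h2 := hup Real.pi ⟨hpi.le, le_rfl⟩
  have h3 := hlow 0 ⟨by linarith, le_rfl⟩
  have h4 := hlow (-Real.pi) ⟨le_rfl, by linarith⟩
  have h5 : u (-Real.pi) = u Real.pi := by
    rw [← hper (-Real.pi)]
    ring_nf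
  simp only [Real.sin_zero, Real.sin_pi, Real.sin_neg, neg_zero, mul_zero] at h1 h2 h3 h4
  exact ⟨by linarith, by linarith, by linarith⟩

lemma eq_of_mem_halfCircle {ε : ℝ} {F f v : ℝ → ℝ} (hF : RisingBranch ε F f)
    (hε : ε = 1 ∨ ε = -1) (hv : Continuous v) (hv0 : v 0 = 0) (hvpi : v Real.pi = 0)
    (hsub : ViscSub ε v) (hsuper : ViscSuper ε v) {t : ℝ} (ht : t ∈ Icc 0 Real.pi) :
    v t = F (min t (Real.pi - t)) := by
  rcases le_total t (Real.pi / 2) with h | h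
  · rw [min_eq_left (by linarith)]
    exact hF.eq_of_visc hε hv hv0 hvpi hsub hsuper t ⟨ht.1, h⟩
  · rw [min_eq_right (by linarith), ← hF.eq_of_visc hε (v := fun y => v (Real.pi - y))
      (by fun_prop) (by simpa using hvpi) (by simpa using hv0) hsub.comp_pi_sub
      hsuper.comp_pi_sub (Real.pi - t) ⟨by linarith [ht.2], by linarith⟩, sub_sub_cancel]

lemma unique {v : ℝ → ℝ} (hu : CircleSolution u) (hv : CircleSolution v) : u = v := by
  obtain ⟨F, f, hF⟩ := exists_risingBranch (Or.inl rfl)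
  obtain ⟨G, g, hG⟩ := exists_risingBranch (Or.inr rfl)
  have key : ∀ w, CircleSolution w → ∀ t ∈ Icc 0 Real.pi,
      w t = F (min t (Real.pi - t)) ∧ w (-t) = G (min t (Real.pi - t)) := by
    intro w hw t ht
    obtain ⟨h0, h1, h2⟩ := hw.eq_zero
    obtain ⟨hc, -, hsub, hsuper⟩ := hw
    exact ⟨eq_of_mem_halfCircle hF (.inl rfl) hc h0 h1 hsub.viscSub hsuper.viscSuper ht,
      eq_of_mem_halfCircle (v := fun y => w (-y)) hG (.inr rfl) (by fun_prop) (by simpa using h0)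
        h2 hsub.viscSub.comp_neg hsuper.viscSuper.comp_neg ht⟩
  funext x
  obtain ⟨n, hn, -⟩ := existsUnique_sub_zsmul_mem_Ico Real.two_pi_pos x (-Real.pi)
  rw [← hu.2.1.sub_zsmul_eq n, ← hv.2.1.sub_zsmul_eq n]
  set y := x - n • (2 * Real.pi)
  rcases le_total 0 y with h | h
  · have hy : y ∈ Icc 0 Real.pi := ⟨h, by linarith [hn.2]⟩
    rw [(key u hu y hy).1, (key v hv y hy).1]
  · have hy : -y ∈ Icc 0 Real.pi := ⟨by linarith, by linarith [hn.1]⟩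
    have h1 := (key u hu _ hy).2
    have h2 := (key v hv _ hy).2
    rw [neg_neg] at h1 h2
    rw [h1, h2]

end CircleSolution

/-- on `𝕊¹`, the equation `(1/2)|u'|² + sin(x)·u + cos(2x) − 1 = 0` has
exactly one continuous viscosity solution: one exists, and any two coincide. -/
theorem stmt_19 :
    (∃ u : ℝ → ℝ, CircleSolution u) ∧
    (∀ u v : ℝ → ℝ, CircleSolution u → CircleSolution v → u = v) := by
  exact ⟨exists_circleSolution, fun _ _ hu hv => hu.unique hv⟩
end
end
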